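/- arXiv:2312.10388 — 6 statements merged into one kernel-verified Lean document; each statement's English description precedes it below -/
import Mathlib

section
/- Let ψ := m̂ + (1_A/π̂) • (Z − m̂). Then ψ is Bochner integrable and E[ψ] − Δ = E[((π̂ − π)/π̂) • (m̂ − m)], so that ‖E[ψ] − Δ‖ ≤ ε⁻¹ · ρ_π · ρ_m. That is, the bias of the double machine learning (DML) score is controlled by the product of the propensity-score error and the outcome-regression error. -/
open MeasureTheory

/-- **The key 'term III' estimate in Theorem 1: bias of the DML score.**
With `ψ := m̂ + (1_A/π̂) • (Z − m̂)`, the score `ψ` is Bochner integrable and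
`E[ψ] − Δ = E[((π̂ − π)/π̂) • (m̂ − m)]`, hence `‖E[ψ] − Δ‖ ≤ ε⁻¹ ρ_π ρ_m`, where
`Δ = E[m]`, `ρ_π = (E[(π̂ − π)²])^{1/2}` and `ρ_m = (E[‖m̂ − m‖²])^{1/2}`. -/
theorem dml_score_bias_bound
    {Ω : Type*} [mΩ : MeasurableSpace Ω] (P : Measure Ω) [IsProbabilityMeasure P]
    {H : Type*} [NormedAddCommGroup H] [InnerProductSpace ℝ H] [CompleteSpace H]
    [SecondCountableTopology H]
    (𝔪 : MeasurableSpace Ω) (h𝔪 : 𝔪 ≤ mΩ)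
    (A : Set Ω) (hA : MeasurableSet[mΩ] A)
    (Z : Ω → H) (hZmeas : StronglyMeasurable[mΩ] Z) (hZ : MemLp Z 2 P)
    (π : Ω → ℝ) (hπmeas : Measurable[𝔪] π)
    (hπver : π =ᵐ[P] P[A.indicator (fun _ => (1 : ℝ)) | 𝔪])
    (ε : ℝ) (hε : ε ∈ Set.Ioo (0 : ℝ) (1/2))
    (hπbdd : ∀ᵐ ω ∂P, π ω ∈ Set.Icc ε (1 - ε))
    (m : Ω → H) (hmmeas : StronglyMeasurable[𝔪] m)
    (hmver : m =ᵐ[P] fun ω => (π ω)⁻¹ • (P[A.indicator Z | 𝔪]) ω)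
    (hm : MemLp m 2 P)
    (πhat : Ω → ℝ) (hπhatmeas : Measurable[𝔪] πhat)
    (hπhatbdd : ∀ᵐ ω ∂P, πhat ω ∈ Set.Icc ε (1 - ε))
    (mhat : Ω → H) (hmhatmeas : StronglyMeasurable[𝔪] mhat)
    (hmhat : MemLp mhat 2 P) :
    Integrable
      (fun ω => mhat ω + (A.indicator (fun _ => (1 : ℝ)) ω / πhat ω) • (Z ω - mhat ω)) P ∧
    ((∫ ω, mhat ω + (A.indicator (fun _ => (1 : ℝ)) ω / πhat ω) • (Z ω - mhat ω) ∂P)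
        - ∫ ω, m ω ∂P
      = ∫ ω, ((πhat ω - π ω) / πhat ω) • (mhat ω - m ω) ∂P) ∧
    ‖(∫ ω, mhat ω + (A.indicator (fun _ => (1 : ℝ)) ω / πhat ω) • (Z ω - mhat ω) ∂P)
        - ∫ ω, m ω ∂P‖
      ≤ ε⁻¹ * Real.sqrt (∫ ω, (πhat ω - π ω) ^ 2 ∂P)
          * Real.sqrt (∫ ω, ‖mhat ω - m ω‖ ^ 2 ∂P) := by
  have hε0 : 0 < ε := hε.1
  have hgm : Measurable[𝔪] (fun ω => (πhat ω)⁻¹) := hπhatmeas.inv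
  have hgs : AEStronglyMeasurable[𝔪] (fun ω => (πhat ω)⁻¹) P :=
    hgm.stronglyMeasurable.aestronglyMeasurable
  have hgs' : AEStronglyMeasurable[mΩ] (fun ω => (πhat ω)⁻¹) P := hgs.mono h𝔪
  have hgb : ∀ᵐ ω ∂P, ‖(πhat ω)⁻¹‖ ≤ ε⁻¹ := by
    filter_upwards [hπhatbdd] with ω h
    rw [Real.norm_eq_abs, abs_of_nonneg (inv_nonneg.2 (hε0.le.trans h.1))]
    exact inv_anti₀ hε0 h.1
  have hπs' : AEStronglyMeasurable[mΩ] π P :=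
    (hπmeas.mono h𝔪 le_rfl).stronglyMeasurable.aestronglyMeasurable
  have hπhs' : AEStronglyMeasurable[mΩ] πhat P :=
    (hπhatmeas.mono h𝔪 le_rfl).stronglyMeasurable.aestronglyMeasurable
  have hb1 : ∀ {f : Ω → ℝ}, (∀ᵐ ω ∂P, f ω ∈ Set.Icc ε (1 - ε)) → ∀ᵐ ω ∂P, ‖f ω‖ ≤ 1 := by
    intro f hf
    filter_upwards [hf] with ω h
    rw [Real.norm_eq_abs, abs_le]
    constructor <;> linarith [h.1, h.2]
  have hmI : Integrable m P := hm.integrable (by norm_num)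
  have hmhI : Integrable mhat P := hmhat.integrable (by norm_num)
  have hZI : Integrable Z P := hZ.integrable (by norm_num)
  have hAZ : Integrable (A.indicator Z) P := hZI.indicator hA
  have h1A : Integrable (A.indicator (fun _ => (1 : ℝ))) P :=
    (integrable_const (1 : ℝ)).indicator hA
  have hgAZ : Integrable ((fun ω => (πhat ω)⁻¹) • A.indicator Z) P :=
    hAZ.bdd_smul _ hgs' hgb
  have hgmh : Integrable ((fun ω => (πhat ω)⁻¹) • mhat) P :=
    hmhI.bdd_smul _ hgs' hgb
  have hgmI : Integrable ((fun ω => (πhat ω)⁻¹) • m) P :=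
    hmI.bdd_smul _ hgs' hgb
  have hAgmh : Integrable
      (A.indicator (fun _ => (1 : ℝ)) • ((fun ω => (πhat ω)⁻¹) • mhat)) P := by
    refine hgmh.bdd_smul 1 h1A.aestronglyMeasurable (Filter.Eventually.of_forall fun ω => ?_)
    by_cases h : ω ∈ A <;> simp [h]
  have hπgm : Integrable (π • ((fun ω => (πhat ω)⁻¹) • m)) P :=
    hgmI.bdd_smul _ hπs' (hb1 hπbdd)
  have hπgmh : Integrable (π • ((fun ω => (πhat ω)⁻¹) • mhat)) P :=
    hgmh.bdd_smul _ hπs' (hb1 hπbdd)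
  have I1 : ∫ ω, ((fun ω => (πhat ω)⁻¹) • A.indicator Z) ω ∂P
      = ∫ ω, (π • ((fun ω => (πhat ω)⁻¹) • m)) ω ∂P := by
    rw [← integral_condExp h𝔪]
    apply integral_congr_ae
    filter_upwards [condExp_smul_of_aestronglyMeasurable_left hgs hgAZ hAZ, hmver, hπbdd]
      with ω h1 h2 h3
    have h0 : π ω ≠ 0 := (hε0.trans_le h3.1).ne'
    rw [h1]
    simp only [Pi.smul_apply', h2]
    rw [smul_comm (π ω), smul_inv_smul₀ h0]
  have I2 : ∫ ω, (A.indicator (fun _ => (1 : ℝ)) • ((fun ω => (πhat ω)⁻¹) • mhat)) ω ∂P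
      = ∫ ω, (π • ((fun ω => (πhat ω)⁻¹) • mhat)) ω ∂P := by
    rw [← integral_condExp h𝔪]
    apply integral_congr_ae
    have hs : AEStronglyMeasurable[𝔪] ((fun ω => (πhat ω)⁻¹) • mhat) P :=
      hgs.smul hmhatmeas.aestronglyMeasurable
    filter_upwards [condExp_smul_of_aestronglyMeasurable_right h1A hAgmh hs, hπver] with ω h1 h2
    rw [h1]
    simp only [Pi.smul_apply', h2]
  have hψ : (fun ω => mhat ω + (A.indicator (fun _ => (1 : ℝ)) ω / πhat ω) • (Z ω - mhat ω))
      = mhat + ((fun ω => (πhat ω)⁻¹) • A.indicator Z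
        - A.indicator (fun _ => (1 : ℝ)) • ((fun ω => (πhat ω)⁻¹) • mhat)) := by
    funext ω
    by_cases h : ω ∈ A <;> simp [h, smul_sub]
  have hψI := hmhI.add (hgAZ.sub hAgmh)
  have key : (∫ ω, mhat ω + (A.indicator (fun _ => (1 : ℝ)) ω / πhat ω) • (Z ω - mhat ω) ∂P)
        - ∫ ω, m ω ∂P
      = ∫ ω, ((πhat ω - π ω) / πhat ω) • (mhat ω - m ω) ∂P := by
    rw [hψ, integral_add' hmhI (hgAZ.sub hAgmh), integral_sub' hgAZ hAgmh, I1, I2,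
      ← integral_sub' hπgm hπgmh, ← integral_add' hmhI (hπgm.sub hπgmh),
      ← integral_sub (hmhI.add (hπgm.sub hπgmh)) hmI]
    apply integral_congr_ae
    filter_upwards [hπhatbdd] with ω h
    have h0 : πhat ω ≠ 0 := (hε0.trans_le h.1).ne'
    simp only [Pi.add_apply, Pi.sub_apply, Pi.smul_apply']
    rw [sub_div, div_self h0, div_eq_mul_inv]
    module
  refine ⟨hψ ▸ hψI, key, ?_⟩
  rw [key]
  have hd : MemLp (fun ω => mhat ω - m ω) 2 P := hmhat.sub hm
  have hp : MemLp (fun ω => πhat ω - π ω) 2 P :=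
    (MemLp.of_bound hπhs' 1 (hb1 hπhatbdd)).sub (MemLp.of_bound hπs' 1 (hb1 hπbdd))
  have hprod : Integrable (fun ω => ‖πhat ω - π ω‖ * ‖mhat ω - m ω‖) P :=
    hp.norm.integrable_mul hd.norm
  have CS := integral_mul_le_Lp_mul_Lq_of_nonneg (μ := P) Real.HolderConjugate.two_two
    (f := fun ω => ‖πhat ω - π ω‖) (g := fun ω => ‖mhat ω - m ω‖)
    (Filter.Eventually.of_forall fun ω => norm_nonneg _)
    (Filter.Eventually.of_forall fun ω => norm_nonneg _)
    (by simpa using hp.norm) (by simpa using hd.norm)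
  simp only [Real.rpow_two, ← Real.sqrt_eq_rpow, Real.norm_eq_abs (_ - _), sq_abs] at CS
  calc _ ≤ ∫ ω, ε⁻¹ * (‖πhat ω - π ω‖ * ‖mhat ω - m ω‖) ∂P := by
        apply norm_integral_le_of_norm_le (hprod.const_mul _)
        filter_upwards [hgb] with ω h
        rw [norm_smul, div_eq_inv_mul, norm_mul, mul_assoc]
        gcongr
    _ ≤ _ := by
        rw [integral_const_mul, mul_assoc]
        gcongr
        simpa only [Real.norm_eq_abs (_ - _)] using CS
end

section
/- Let ψ := m̂ + (1_A/π̂) • (Z − m̂). If π̂ = π P-almost surely, or if m̂ = m P-almost surely, then E[ψ] = Δ. That is, the double machine learning score is doubly robust: it is unbiased for the causal map as soon as either the propensity score or the outcome regression is correctly specified. -/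
open MeasureTheory

/-- **Double robustness of the DML score.**
With `ψ := m̂ + (1_A/π̂) • (Z − m̂)`, if `π̂ = π` a.s. or `m̂ = m` a.s., then
`E[ψ] = Δ`, where `Δ = E[m]` is the causal map. -/
theorem dml_score_doubly_robust
    {Ω : Type*} [mΩ : MeasurableSpace Ω] (P : Measure Ω) [IsProbabilityMeasure P]
    {H : Type*} [NormedAddCommGroup H] [InnerProductSpace ℝ H] [CompleteSpace H]
    [SecondCountableTopology H]
    (𝔪 : MeasurableSpace Ω) (h𝔪 : 𝔪 ≤ mΩ)
    (A : Set Ω) (hA : MeasurableSet[mΩ] A)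
    (Z : Ω → H) (hZmeas : StronglyMeasurable[mΩ] Z) (hZ : MemLp Z 2 P)
    (π : Ω → ℝ) (hπmeas : Measurable[𝔪] π)
    (hπver : π =ᵐ[P] P[A.indicator (fun _ => (1 : ℝ)) | 𝔪])
    (ε : ℝ) (hε : ε ∈ Set.Ioo (0 : ℝ) (1/2))
    (hπbdd : ∀ᵐ ω ∂P, π ω ∈ Set.Icc ε (1 - ε))
    (m : Ω → H) (hmmeas : StronglyMeasurable[𝔪] m)
    (hmver : m =ᵐ[P] fun ω => (π ω)⁻¹ • (P[A.indicator Z | 𝔪]) ω)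
    (hm : MemLp m 2 P)
    (πhat : Ω → ℝ) (hπhatmeas : Measurable[𝔪] πhat)
    (hπhatbdd : ∀ᵐ ω ∂P, πhat ω ∈ Set.Icc ε (1 - ε))
    (mhat : Ω → H) (hmhatmeas : StronglyMeasurable[𝔪] mhat)
    (hmhat : MemLp mhat 2 P) :
    (πhat =ᵐ[P] π ∨ mhat =ᵐ[P] m) →
      (∫ ω, mhat ω + (A.indicator (fun _ => (1 : ℝ)) ω / πhat ω) • (Z ω - mhat ω) ∂P)
        = ∫ ω, m ω ∂P := by
  intro hor
  have hε0 : 0 < ε := hε.1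
  have hZi : Integrable Z P := hZ.integrable (by norm_num)
  have hmi : Integrable m P := hm.integrable (by norm_num)
  have hmhi : Integrable mhat P := hmhat.integrable (by norm_num)
  have hAZ : Integrable (A.indicator Z) P := hZi.indicator hA
  have h1 : Integrable (A.indicator (fun _ => (1 : ℝ))) P := (integrable_const (1 : ℝ)).indicator hA
  have hAm : Integrable (A.indicator (fun _ => (1 : ℝ)) • mhat) P := by
    have : A.indicator (fun _ => (1 : ℝ)) • mhat = A.indicator mhat := by
      ext ω
      by_cases h : ω ∈ A <;> simp [h]
    rw [this]
    exact hmhi.indicator hA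
  have hg : Integrable (A.indicator Z - A.indicator (fun _ => (1 : ℝ)) • mhat) P := hAZ.sub hAm
  have hinvm : StronglyMeasurable[𝔪] (fun ω => (πhat ω)⁻¹) :=
    (Measurable.inv (m := 𝔪) hπhatmeas).stronglyMeasurable
  have hbd : ∀ᵐ ω ∂P, ‖(πhat ω)⁻¹‖ ≤ ε⁻¹ := by
    filter_upwards [hπhatbdd] with ω h
    have hp : 0 < πhat ω := hε0.trans_le h.1
    rw [Real.norm_of_nonneg (inv_nonneg.2 hp.le)]
    exact inv_anti₀ hε0 h.1
  have hfg : Integrable ((fun ω => (πhat ω)⁻¹) •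
      (A.indicator Z - A.indicator (fun _ => (1 : ℝ)) • mhat)) P :=
    hg.bdd_smul ε⁻¹ (hinvm.mono h𝔪).aestronglyMeasurable hbd
  have hc1 := condExp_smul_of_aestronglyMeasurable_left (m := 𝔪)
    hinvm.aestronglyMeasurable hfg hg
  have hc2 := condExp_smul_of_aestronglyMeasurable_right (m := 𝔪) h1 hAm
    hmhatmeas.aestronglyMeasurable
  have hc3 := condExp_sub hAZ hAm 𝔪
  have key : P[(fun ω => (πhat ω)⁻¹) •
      (A.indicator Z - A.indicator (fun _ => (1 : ℝ)) • mhat) | 𝔪] =ᵐ[P] m - mhat := by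
    filter_upwards [hc1, hc2, hc3, hπver, hmver, hπbdd, (show ∀ᵐ ω ∂P, πhat ω = π ω ∨ mhat ω = m ω from
      hor.elim (fun h => h.mono fun _ => Or.inl) (fun h => h.mono fun _ => Or.inr))]
      with ω e1 e2 e3 e4 e5 e6 e7
    have hp : π ω ≠ 0 := (hε0.trans_le e6.1).ne'
    have e8 : (P[A.indicator Z | 𝔪]) ω = π ω • m ω := by
      rw [e5, smul_inv_smul₀ hp]
    rw [e1, Pi.smul_apply', e3, Pi.sub_apply, e2, Pi.smul_apply', ← e4, e8, ← smul_sub, Pi.sub_apply]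
    rcases e7 with h | h
    · rw [h, inv_smul_smul₀ hp]
    · simp [h]
  have hrew : (fun ω => mhat ω + (A.indicator (fun _ => (1 : ℝ)) ω / πhat ω) • (Z ω - mhat ω)) =
      fun ω => mhat ω + ((fun ω => (πhat ω)⁻¹) •
      (A.indicator Z - A.indicator (fun _ => (1 : ℝ)) • mhat)) ω := by
    ext ω
    by_cases h : ω ∈ A <;> simp [h]
  rw [hrew, integral_add hmhi hfg, ← integral_condExp h𝔪 (f := (fun ω => (πhat ω)⁻¹) • _),
    integral_congr_ae key, integral_sub' hmi hmhi]
  abel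
end

section
/- Let ψ := m̂ + (1_A/π̂) • (Z − m̂), and let ψ₁, …, ψ_n : Ω → H be mutually independent random elements, each identically distributed with ψ. Then E[‖(1/n) Σ_{s=1}^n ψ_s − Δ‖²] = (1/n) · E[‖ψ − E[ψ]‖²] + ‖E[ψ] − Δ‖² ≤ (1/n) · E[‖ψ − E[ψ]‖²] + ε⁻² · ρ_π² · ρ_m². In particular, within one cross-fitting fold with fixed nuisance estimates, the mean-squared error of the DML estimator of the causal map is of order n⁻¹ plus the squared product of the nuisance errors. -/
open MeasureTheory ProbabilityTheory

theorem dml_aux_cs {Ω : Type*} {mΩ : MeasurableSpace Ω} {P : Measure Ω} {f g : Ω → ℝ}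
    (hf0 : ∀ ω, 0 ≤ f ω) (hg0 : ∀ ω, 0 ≤ g ω) (hf : MemLp f 2 P) (hg : MemLp g 2 P) :
    (∫ ω, f ω * g ω ∂P) ^ 2 ≤ (∫ ω, f ω ^ 2 ∂P) * ∫ ω, g ω ^ 2 ∂P := by
  have h := integral_mul_le_Lp_mul_Lq_of_nonneg (μ := P) Real.HolderConjugate.two_two
    (Filter.Eventually.of_forall hf0) (Filter.Eventually.of_forall hg0)
    (by simpa using hf) (by simpa using hg)
  simp only [Real.rpow_two, ← Real.sqrt_eq_rpow] at h
  have h0 : 0 ≤ ∫ ω, f ω * g ω ∂P := integral_nonneg fun ω => mul_nonneg (hf0 ω) (hg0 ω)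
  have h1 : 0 ≤ ∫ ω, f ω ^ 2 ∂P := integral_nonneg fun ω => sq_nonneg _
  have h2 : 0 ≤ ∫ ω, g ω ^ 2 ∂P := integral_nonneg fun ω => sq_nonneg _
  calc _ ≤ _ := pow_le_pow_left₀ h0 h 2
    _ = _ := by rw [mul_pow, Real.sq_sqrt h1, Real.sq_sqrt h2]

theorem dml_aux_integrable_inner {Ω : Type*} {mΩ : MeasurableSpace Ω} {P : Measure Ω}
    {H : Type*} [NormedAddCommGroup H] [InnerProductSpace ℝ H] {f g : Ω → H}
    (hf : MemLp f 2 P) (hg : MemLp g 2 P) : Integrable (fun ω => inner ℝ (f ω) (g ω)) P := by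
  refine (hf.norm.integrable_mul hg.norm).mono (hf.1.inner hg.1) ?_
  filter_upwards with ω
  simpa using norm_inner_le_norm (𝕜 := ℝ) (f ω) (g ω)

theorem dml_aux_mse {Ω : Type*} {mΩ : MeasurableSpace Ω} {P : Measure Ω} [IsProbabilityMeasure P]
    {H : Type*} [NormedAddCommGroup H] [InnerProductSpace ℝ H] [CompleteSpace H]
    [SecondCountableTopology H] [MeasurableSpace H] [BorelSpace H]
    {ψ : Ω → H} (hψ : MemLp ψ 2 P) {n : ℕ} (hn : 0 < n) (ψs : Fin n → Ω → H)
    (hindep : iIndepFun ψs P) (hident : ∀ s, IdentDistrib (ψs s) ψ P P) (Δ : H) :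
    ∫ ω, ‖(n : ℝ)⁻¹ • ∑ s, ψs s ω - Δ‖ ^ 2 ∂P
        = (n : ℝ)⁻¹ * (∫ ω, ‖ψ ω - ∫ ω', ψ ω' ∂P‖ ^ 2 ∂P)
          + ‖(∫ ω, ψ ω ∂P) - Δ‖ ^ 2 := by
  set μ := ∫ ω, ψ ω ∂P with hμ
  have hn' : (n : ℝ) ≠ 0 := by positivity
  have hs2 : ∀ s, MemLp (ψs s) 2 P := fun s => (hident s).symm.memLp_snd hψ
  set W : Fin n → Ω → H := fun s ω => ψs s ω - μ with hW
  have hW2 : ∀ s, MemLp (W s) 2 P := fun s => (hs2 s).sub (memLp_const μ)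
  have hW1 : ∀ s, Integrable (W s) P := fun s => (hW2 s).integrable (by norm_num)
  have hWint : ∀ s, ∫ ω, W s ω ∂P = 0 := by
    intro s
    rw [hW]
    simp only
    rw [integral_sub ((hs2 s).integrable (by norm_num)) (integrable_const _),
      (hident s).integral_eq]
    simp [hμ]
  have hWsq : ∀ s, ∫ ω, inner ℝ (W s ω) (W s ω) ∂P = ∫ ω, ‖ψ ω - μ‖ ^ 2 ∂P := by
    intro s
    simp only [real_inner_self_eq_norm_sq]
    have hc : Measurable (fun x : H => ‖x - μ‖ ^ 2) := by fun_prop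
    exact ((hident s).comp hc).integral_eq
  have hcross : ∀ i j, i ≠ j → ∫ ω, inner ℝ (W i ω) (W j ω) ∂P = 0 := by
    intro i j hij
    have hc : Measurable (fun x : H => x - μ) := by fun_prop
    have hI : IndepFun (W i) (W j) P := (hindep.indepFun hij).comp hc hc
    have := hI.integral_bilin (hW1 i) (hW1 j) (innerSL ℝ)
    rw [hWint, hWint, map_zero] at this
    exact this
  have hpt : ∀ ω, ‖(n : ℝ)⁻¹ • ∑ s, ψs s ω - Δ‖ ^ 2
      = (n : ℝ)⁻¹ ^ 2 * (∑ i, ∑ j, inner ℝ (W i ω) (W j ω))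
        + (2 * (n : ℝ)⁻¹) * (∑ i, inner ℝ (μ - Δ) (W i ω)) + ‖μ - Δ‖ ^ 2 := by
    intro ω
    have : (n : ℝ)⁻¹ • ∑ s, ψs s ω - Δ = (n : ℝ)⁻¹ • ∑ s, W s ω + (μ - Δ) := by
      simp only [hW, Finset.sum_sub_distrib, smul_sub, Finset.sum_const, Finset.card_univ,
        Fintype.card_fin]
      rw [← Nat.cast_smul_eq_nsmul ℝ, smul_smul, inv_mul_cancel₀ hn', one_smul]
      abel
    rw [this, norm_add_sq_real, norm_smul, mul_pow, real_inner_smul_left,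
      ← real_inner_self_eq_norm_sq (∑ s, W s ω), sum_inner, real_inner_comm, inner_sum]
    simp only [inner_sum, Real.norm_eq_abs, sq_abs]
    ring
  simp only [hpt]
  have i1 : ∀ i j, Integrable (fun ω => inner ℝ (W i ω) (W j ω)) P :=
    fun i j => dml_aux_integrable_inner (hW2 i) (hW2 j)
  have i2 : ∀ i, Integrable (fun ω => inner ℝ (μ - Δ) (W i ω)) P :=
    fun i => (hW1 i).const_inner _
  have i3 : Integrable (fun ω => ∑ i, ∑ j, inner ℝ (W i ω) (W j ω)) P :=
    integrable_finsetSum _ fun i _ => integrable_finsetSum _ fun j _ => i1 i j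
  have i4 : Integrable (fun ω => ∑ i, inner ℝ (μ - Δ) (W i ω)) P :=
    integrable_finsetSum _ fun i _ => i2 i
  have i5 : Integrable (fun ω => (n : ℝ)⁻¹ ^ 2 * (∑ i, ∑ j, inner ℝ (W i ω) (W j ω))
        + (2 * (n : ℝ)⁻¹) * (∑ i, inner ℝ (μ - Δ) (W i ω))) P :=
    (i3.const_mul _).add (i4.const_mul _)
  rw [integral_add i5 (integrable_const _),
    integral_add (i3.const_mul _) (i4.const_mul _), integral_const_mul, integral_const_mul,
    integral_finsetSum _ (fun i _ => i2 i),
    integral_finsetSum _ (fun i _ => integrable_finsetSum _ fun j _ => i1 i j)]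
  have e1 : ∀ i, ∫ ω, ∑ j, inner ℝ (W i ω) (W j ω) ∂P = ∫ ω, ‖ψ ω - μ‖ ^ 2 ∂P := by
    intro i
    rw [integral_finsetSum _ (fun j _ => i1 i j), Finset.sum_eq_single i
      (fun j _ hj => hcross i j hj.symm) (by simp), hWsq]
  have e2 : ∀ i, ∫ ω, inner ℝ (μ - Δ) (W i ω) ∂P = 0 := by
    intro i
    rw [integral_inner (hW1 i), hWint, inner_zero_right]
  simp only [e1, e2]
  simp
  field_simp

theorem dml_aux_memLp {Ω : Type*} {mΩ : MeasurableSpace Ω} {P : Measure Ω}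
    {H : Type*} [NormedAddCommGroup H] [NormedSpace ℝ H]
    {f : Ω → ℝ} {g : Ω → H} (c : ℝ) (hf : AEStronglyMeasurable f P)
    (hb : ∀ᵐ ω ∂P, |f ω| ≤ c) (hg : MemLp g 2 P) : MemLp (fun ω => f ω • g ω) 2 P := by
  refine hg.of_le_mul (c := c) (hf.smul hg.1) ?_
  filter_upwards [hb] with ω h
  rw [norm_smul, Real.norm_eq_abs]
  gcongr

theorem dml_aux_bias {Ω : Type*} {𝔪 mΩ : MeasurableSpace Ω} {P : Measure Ω} [IsProbabilityMeasure P]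
    {H : Type*} [NormedAddCommGroup H] [InnerProductSpace ℝ H] [CompleteSpace H]
    (h𝔪 : 𝔪 ≤ mΩ)
    (A : Set Ω) (hA : MeasurableSet[mΩ] A)
    (Z : Ω → H) (hZ : MemLp Z 2 P)
    (π : Ω → ℝ) (hπmeas : Measurable[𝔪] π)
    (hπver : π =ᵐ[P] P[A.indicator (fun _ => (1 : ℝ)) | 𝔪])
    (ε : ℝ) (hε : ε ∈ Set.Ioo (0 : ℝ) (1/2))
    (hπbdd : ∀ᵐ ω ∂P, π ω ∈ Set.Icc ε (1 - ε))
    (m : Ω → H) 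
    (hmver : m =ᵐ[P] fun ω => (π ω)⁻¹ • (P[A.indicator Z | 𝔪]) ω)
    (hm : MemLp m 2 P)
    (πhat : Ω → ℝ) (hπhatmeas : Measurable[𝔪] πhat)
    (hπhatbdd : ∀ᵐ ω ∂P, πhat ω ∈ Set.Icc ε (1 - ε))
    (mhat : Ω → H) (hmhatmeas : StronglyMeasurable[𝔪] mhat)
    (hmhat : MemLp mhat 2 P)
    (ψ : Ω → H)
    (hψdef : ψ = fun ω =>
      mhat ω + (A.indicator (fun _ => (1 : ℝ)) ω / πhat ω) • (Z ω - mhat ω)) :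
    MemLp ψ 2 P ∧ ‖(∫ ω, ψ ω ∂P) - ∫ ω', m ω' ∂P‖ ^ 2 ≤
      ε⁻¹ ^ 2 * (∫ ω, (πhat ω - π ω) ^ 2 ∂P) * ∫ ω, ‖mhat ω - m ω‖ ^ 2 ∂P := by
  have hε0 := hε.1
  set I : Ω → ℝ := A.indicator (fun _ => (1 : ℝ)) with hI
  have hImeas : AEStronglyMeasurable I P :=
    (stronglyMeasurable_const.indicator hA).aestronglyMeasurable
  have hIb : ∀ᵐ ω ∂P, |I ω| ≤ 1 := by
    filter_upwards with ω
    by_cases h : ω ∈ A <;> simp [hI, h]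
  have hIint : Integrable I P := (integrable_const 1).indicator hA
  have hpinvm : StronglyMeasurable[𝔪] (fun ω => (πhat ω)⁻¹) :=
    (hπhatmeas.inv).stronglyMeasurable
  have hpinv : AEStronglyMeasurable (fun ω => (πhat ω)⁻¹) P :=
    (hpinvm.mono h𝔪).aestronglyMeasurable
  have hpinvb : ∀ᵐ ω ∂P, |(πhat ω)⁻¹| ≤ ε⁻¹ := by
    filter_upwards [hπhatbdd] with ω h
    rw [abs_inv, abs_of_pos (hε0.trans_le h.1)]
    exact inv_anti₀ hε0 h.1
  have hπae : AEStronglyMeasurable π P :=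
    ((hπmeas.stronglyMeasurable).mono h𝔪).aestronglyMeasurable
  have hπhatae : AEStronglyMeasurable πhat P :=
    ((hπhatmeas.stronglyMeasurable).mono h𝔪).aestronglyMeasurable
  have hπb : ∀ᵐ ω ∂P, |π ω| ≤ 1 := by
    filter_upwards [hπbdd] with ω h
    rw [abs_le]; constructor <;> linarith [h.1, h.2]
  have hπhatb : ∀ᵐ ω ∂P, |πhat ω| ≤ 1 := by
    filter_upwards [hπhatbdd] with ω h
    rw [abs_le]; constructor <;> linarith [h.1, h.2]
  have hIZ : A.indicator Z = fun ω => I ω • Z ω := by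
    ext ω
    by_cases h : ω ∈ A <;> simp [hI, h]
  have hIZ2 : MemLp (A.indicator Z) 2 P := hZ.indicator hA
  -- the pieces
  have u2 : MemLp (fun ω => (πhat ω)⁻¹ • A.indicator Z ω) 2 P :=
    dml_aux_memLp _ hpinv hpinvb hIZ2
  have v2 : MemLp (fun ω => (πhat ω)⁻¹ • mhat ω) 2 P :=
    dml_aux_memLp _ hpinv hpinvb hmhat
  have w2 : MemLp (fun ω => I ω • ((πhat ω)⁻¹ • mhat ω)) 2 P :=
    dml_aux_memLp _ hImeas hIb v2
  have hψeq : ψ = fun ω => mhat ω + (πhat ω)⁻¹ • A.indicator Z ω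
      - I ω • ((πhat ω)⁻¹ • mhat ω) := by
    rw [hψdef, hIZ]
    ext ω
    simp only [div_eq_mul_inv, smul_sub, smul_smul]
    rw [mul_comm (πhat ω)⁻¹]
    abel
  have hψ2 : MemLp ψ 2 P := by rw [hψeq]; exact (hmhat.add u2).sub w2
  refine ⟨hψ2, ?_⟩
  have h12 : (1 : ENNReal) ≤ 2 := by norm_num
  have c1 : ∫ ω, (πhat ω)⁻¹ • A.indicator Z ω ∂P = ∫ ω, (πhat ω)⁻¹ • (π ω • m ω) ∂P := by
    have h := condExp_smul_of_aestronglyMeasurable_left (m := 𝔪) (μ := P)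
      hpinvm.aestronglyMeasurable (u2.integrable h12) (hIZ2.integrable h12)
    have h2 := integral_condExp (μ := P) h𝔪 (f := (fun ω => (πhat ω)⁻¹) • A.indicator Z)
    have h3 : ∫ ω, ((fun ω => (πhat ω)⁻¹) • A.indicator Z) ω ∂P
      = ∫ ω, (πhat ω)⁻¹ • A.indicator Z ω ∂P := rfl
    rw [← h3, ← h2]
    refine integral_congr_ae ?_
    filter_upwards [h, hmver, hπbdd] with ω h1 h2 h3
    rw [h1, h2, smul_smul (π ω), mul_inv_cancel₀ (hε0.trans_le h3.1).ne', one_smul]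
    rfl
  have c2 : ∫ ω, I ω • ((πhat ω)⁻¹ • mhat ω) ∂P = ∫ ω, π ω • ((πhat ω)⁻¹ • mhat ω) ∂P := by
    have h := condExp_smul_of_aestronglyMeasurable_right (m := 𝔪) (μ := P)
      hIint (w2.integrable h12) (hpinvm.smul hmhatmeas).aestronglyMeasurable
    have h2 := integral_condExp (μ := P) h𝔪 (f := I • fun ω => (πhat ω)⁻¹ • mhat ω)
    have h3 : ∫ ω, (I • fun ω => (πhat ω)⁻¹ • mhat ω) ω ∂P
      = ∫ ω, I ω • ((πhat ω)⁻¹ • mhat ω) ∂P := rfl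
    rw [← h3, ← h2]
    refine integral_congr_ae ?_
    filter_upwards [h, hπver] with ω h1 h2
    rw [h2]
    exact h1
  have a2 : MemLp (fun ω => (πhat ω)⁻¹ • (π ω • m ω)) 2 P :=
    dml_aux_memLp _ hpinv hpinvb (dml_aux_memLp _ hπae hπb hm)
  have b2 : MemLp (fun ω => π ω • ((πhat ω)⁻¹ • mhat ω)) 2 P :=
    dml_aux_memLp _ hπae hπb v2
  have key : (∫ ω, ψ ω ∂P) - ∫ ω', m ω' ∂P
      = ∫ ω, ((πhat ω)⁻¹ * (πhat ω - π ω)) • (mhat ω - m ω) ∂P := by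
    have k1 : Integrable (fun ω => mhat ω + (πhat ω)⁻¹ • A.indicator Z ω) P :=
      (hmhat.add u2).integrable h12
    have k2 : Integrable (fun ω => mhat ω + (πhat ω)⁻¹ • (π ω • m ω)) P :=
      (hmhat.add a2).integrable h12
    have k3 : Integrable (fun ω => mhat ω + (πhat ω)⁻¹ • (π ω • m ω)
        - π ω • ((πhat ω)⁻¹ • mhat ω)) P := ((hmhat.add a2).sub b2).integrable h12
    rw [hψeq, integral_sub k1 (w2.integrable h12),
      integral_add (hmhat.integrable h12) (u2.integrable h12), c1, c2,
      ← integral_add (hmhat.integrable h12) (a2.integrable h12),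
      ← integral_sub k2 (b2.integrable h12),
      ← integral_sub k3 (hm.integrable h12)]
    refine integral_congr_ae ?_
    filter_upwards [hπhatbdd] with ω h
    have h0 : πhat ω ≠ 0 := (hε0.trans_le h.1).ne'
    rw [mul_sub, inv_mul_cancel₀ h0]
    module
  have d2 : MemLp (fun ω => |πhat ω - π ω|) 2 P := by
    have := (MemLp.of_bound hπhatae 1 hπhatb : MemLp πhat 2 P).sub
      (MemLp.of_bound hπae 1 hπb : MemLp π 2 P)
    exact this.norm
  have e2 : MemLp (fun ω => ‖mhat ω - m ω‖) 2 P := (hmhat.sub hm).norm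
  have hle : ‖(∫ ω, ψ ω ∂P) - ∫ ω', m ω' ∂P‖
      ≤ ε⁻¹ * ∫ ω, |πhat ω - π ω| * ‖mhat ω - m ω‖ ∂P := by
    rw [key, ← integral_const_mul]
    refine norm_integral_le_of_norm_le ((d2.integrable_mul e2).const_mul _) ?_
    filter_upwards [hpinvb] with ω h
    rw [norm_smul, norm_mul, Real.norm_eq_abs, Real.norm_eq_abs, ← mul_assoc]
    gcongr
  have hcs := dml_aux_cs (P := P) (fun ω => abs_nonneg (πhat ω - π ω))
    (fun ω => norm_nonneg (mhat ω - m ω)) d2 e2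
  simp only [sq_abs] at hcs
  calc _ ≤ _ := pow_le_pow_left₀ (norm_nonneg _) hle 2
    _ = ε⁻¹ ^ 2 * (∫ ω, |πhat ω - π ω| * ‖mhat ω - m ω‖ ∂P) ^ 2 := mul_pow _ _ _
    _ ≤ _ := by rw [mul_assoc]; gcongr

/-- **Finite-sample core of Theorem 1, Assertion 1: MSE of the DML estimator within a
cross-fitting fold.** With `ψ := m̂ + (1_A/π̂) • (Z − m̂)` and `ψ₁, …, ψ_n` i.i.d. copies
of `ψ`, one has
`E[‖(1/n) Σ_s ψ_s − Δ‖²] = (1/n) E[‖ψ − E[ψ]‖²] + ‖E[ψ] − Δ‖²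
  ≤ (1/n) E[‖ψ − E[ψ]‖²] + ε⁻² ρ_π² ρ_m²`,
where `Δ = E[m]`, `ρ_π = (E[(π̂ − π)²])^{1/2}` and `ρ_m = (E[‖m̂ − m‖²])^{1/2}`. -/
theorem dml_estimator_mse_bound
    {Ω : Type*} [mΩ : MeasurableSpace Ω] (P : Measure Ω) [IsProbabilityMeasure P]
    {H : Type*} [NormedAddCommGroup H] [InnerProductSpace ℝ H] [CompleteSpace H]
    [SecondCountableTopology H] [MeasurableSpace H] [BorelSpace H]
    (𝔪 : MeasurableSpace Ω) (h𝔪 : 𝔪 ≤ mΩ)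
    (A : Set Ω) (hA : MeasurableSet[mΩ] A)
    (Z : Ω → H) (hZmeas : StronglyMeasurable[mΩ] Z) (hZ : MemLp Z 2 P)
    (π : Ω → ℝ) (hπmeas : Measurable[𝔪] π)
    (hπver : π =ᵐ[P] P[A.indicator (fun _ => (1 : ℝ)) | 𝔪])
    (ε : ℝ) (hε : ε ∈ Set.Ioo (0 : ℝ) (1/2))
    (hπbdd : ∀ᵐ ω ∂P, π ω ∈ Set.Icc ε (1 - ε))
    (m : Ω → H) (hmmeas : StronglyMeasurable[𝔪] m)
    (hmver : m =ᵐ[P] fun ω => (π ω)⁻¹ • (P[A.indicator Z | 𝔪]) ω)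
    (hm : MemLp m 2 P)
    (πhat : Ω → ℝ) (hπhatmeas : Measurable[𝔪] πhat)
    (hπhatbdd : ∀ᵐ ω ∂P, πhat ω ∈ Set.Icc ε (1 - ε))
    (mhat : Ω → H) (hmhatmeas : StronglyMeasurable[𝔪] mhat)
    (hmhat : MemLp mhat 2 P)
    (ψ : Ω → H)
    (hψdef : ψ = fun ω =>
      mhat ω + (A.indicator (fun _ => (1 : ℝ)) ω / πhat ω) • (Z ω - mhat ω))
    {n : ℕ} (hn : 0 < n) (ψs : Fin n → Ω → H)
    (hindep : iIndepFun (_mΩ := mΩ) (m := fun _ => (inferInstance : MeasurableSpace H)) ψs P)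
    (hident : ∀ s, @IdentDistrib Ω Ω H mΩ mΩ _ (ψs s) ψ P P) :
    (∫ ω, ‖(n : ℝ)⁻¹ • ∑ s, ψs s ω - ∫ ω', m ω' ∂P‖ ^ 2 ∂P
        = (n : ℝ)⁻¹ * (∫ ω, ‖ψ ω - ∫ ω', ψ ω' ∂P‖ ^ 2 ∂P)
          + ‖(∫ ω, ψ ω ∂P) - ∫ ω', m ω' ∂P‖ ^ 2) ∧
    (∫ ω, ‖(n : ℝ)⁻¹ • ∑ s, ψs s ω - ∫ ω', m ω' ∂P‖ ^ 2 ∂P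
        ≤ (n : ℝ)⁻¹ * (∫ ω, ‖ψ ω - ∫ ω', ψ ω' ∂P‖ ^ 2 ∂P)
          + ε⁻¹ ^ 2 * (∫ ω, (πhat ω - π ω) ^ 2 ∂P)
              * ∫ ω, ‖mhat ω - m ω‖ ^ 2 ∂P) := by
  obtain ⟨hψ2, hbias⟩ := dml_aux_bias h𝔪 A hA Z hZ π hπmeas hπver ε hε hπbdd m hmver hm πhat
    hπhatmeas hπhatbdd mhat hmhatmeas hmhat ψ hψdef
  have hmse := dml_aux_mse hψ2 hn ψs hindep hident (∫ ω', m ω' ∂P)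
  refine ⟨hmse, ?_⟩
  rw [hmse]
  exact add_le_add le_rfl hbias
end

section
/- Let η := (1_A/π̂) • Z. Then ‖E[η] − Δ‖ = ‖E[((π − π̂)/π̂) • m]‖ ≤ ε⁻¹ · ρ_π · (E[‖m‖²])^{1/2}. That is, the bias of the Inverse Propensity Weighting (IPW) score is controlled by the L² error of the propensity-score estimate. -/
open MeasureTheory

/-- **Bias bound for the Inverse Propensity Weighting (IPW) score (Appendix C).**
With `η := (1_A/π̂) • Z`, one has
`‖E[η] − Δ‖ = ‖E[((π − π̂)/π̂) • m]‖ ≤ ε⁻¹ ρ_π (E[‖m‖²])^{1/2}`, where `Δ = E[m]` is the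
causal map and `ρ_π = (E[(π̂ − π)²])^{1/2}`. -/
theorem ipw_score_bias_bound
    {Ω : Type*} [mΩ : MeasurableSpace Ω] (P : Measure Ω) [IsProbabilityMeasure P]
    {H : Type*} [NormedAddCommGroup H] [InnerProductSpace ℝ H] [CompleteSpace H]
    [SecondCountableTopology H]
    (𝔪 : MeasurableSpace Ω) (h𝔪 : 𝔪 ≤ mΩ)
    (A : Set Ω) (hA : MeasurableSet[mΩ] A)
    (Z : Ω → H) (hZmeas : StronglyMeasurable[mΩ] Z) (hZ : MemLp Z 2 P)
    (π : Ω → ℝ) (hπmeas : Measurable[𝔪] π)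
    (hπver : π =ᵐ[P] P[A.indicator (fun _ => (1 : ℝ)) | 𝔪])
    (ε : ℝ) (hε : ε ∈ Set.Ioo (0 : ℝ) (1/2))
    (hπbdd : ∀ᵐ ω ∂P, π ω ∈ Set.Icc ε (1 - ε))
    (m : Ω → H) (hmmeas : StronglyMeasurable[𝔪] m)
    (hmver : m =ᵐ[P] fun ω => (π ω)⁻¹ • (P[A.indicator Z | 𝔪]) ω)
    (hm : MemLp m 2 P)
    (πhat : Ω → ℝ) (hπhatmeas : Measurable[𝔪] πhat)
    (hπhatbdd : ∀ᵐ ω ∂P, πhat ω ∈ Set.Icc ε (1 - ε)) :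
    ‖(∫ ω, (A.indicator (fun _ => (1 : ℝ)) ω / πhat ω) • Z ω ∂P) - ∫ ω, m ω ∂P‖
        = ‖∫ ω, ((π ω - πhat ω) / πhat ω) • m ω ∂P‖ ∧
    ‖(∫ ω, (A.indicator (fun _ => (1 : ℝ)) ω / πhat ω) • Z ω ∂P) - ∫ ω, m ω ∂P‖
        ≤ ε⁻¹ * Real.sqrt (∫ ω, (πhat ω - π ω) ^ 2 ∂P)
            * Real.sqrt (∫ ω, ‖m ω‖ ^ 2 ∂P) := by
  obtain ⟨hε0, hε1⟩ := hε
  have hZi : Integrable Z P := hZ.integrable (by norm_num)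
  have hmi : Integrable m P := hm.integrable (by norm_num)
  have hAZ : Integrable (A.indicator Z) P := hZi.indicator hA
  have hinvm : StronglyMeasurable[𝔪] (fun ω => (πhat ω)⁻¹) := hπhatmeas.inv.stronglyMeasurable
  have hπ0 := hπmeas.mono h𝔪 le_rfl
  have hπh0 := hπhatmeas.mono h𝔪 le_rfl
  have hinvb : ∀ᵐ ω ∂P, ‖(πhat ω)⁻¹‖ ≤ ε⁻¹ := by
    filter_upwards [hπhatbdd] with ω h
    have h0 : 0 < πhat ω := hε0.trans_le h.1
    rw [norm_inv, Real.norm_of_nonneg h0.le]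
    exact inv_anti₀ hε0 h.1
  have hint : Integrable ((fun ω => (πhat ω)⁻¹) • A.indicator Z) P :=
    hAZ.bdd_smul ε⁻¹ (hinvm.mono h𝔪).aestronglyMeasurable hinvb
  have hpull := condExp_smul_of_aestronglyMeasurable_left (m := 𝔪) (μ := P)
    hinvm.aestronglyMeasurable hint hAZ
  have hratio : ∀ᵐ ω ∂P, ‖(π ω - πhat ω) / πhat ω‖ ≤ ε⁻¹ * |πhat ω - π ω| := by
    filter_upwards [hinvb] with ω h
    rw [div_eq_inv_mul, norm_mul, Real.norm_eq_abs (_ - _), abs_sub_comm]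
    exact mul_le_mul_of_nonneg_right h (abs_nonneg _)
  have hdiffb : ∀ᵐ ω ∂P, |πhat ω - π ω| ≤ 1 := by
    filter_upwards [hπbdd, hπhatbdd] with ω h1 h2
    rw [abs_le]; constructor <;> linarith [h1.1, h1.2, h2.1, h2.2]
  have hri : Integrable (fun ω => ((π ω - πhat ω) / πhat ω) • m ω) P := by
    refine hmi.bdd_smul ε⁻¹ ((hπ0.sub hπh0).div hπh0).aestronglyMeasurable ?_
    filter_upwards [hratio, hdiffb] with ω h1 h2
    refine h1.trans ?_
    simpa using mul_le_mul_of_nonneg_left h2 (inv_nonneg.2 hε0.le)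
  have hE : (∫ ω, (A.indicator (fun _ => (1 : ℝ)) ω / πhat ω) • Z ω ∂P)
      = ∫ ω, (((π ω - πhat ω) / πhat ω) • m ω + m ω) ∂P := by
    have e1 : (fun ω => (A.indicator (fun _ => (1 : ℝ)) ω / πhat ω) • Z ω)
        = (fun ω => (πhat ω)⁻¹) • A.indicator Z := by
      funext ω
      by_cases h : ω ∈ A <;> simp [h]
    rw [e1, ← integral_condExp h𝔪]
    refine integral_congr_ae ?_
    filter_upwards [hpull, hmver, hπbdd, hπhatbdd] with ω h1 h2 h3 h4
    have h5 : π ω ≠ 0 := (hε0.trans_le h3.1).ne'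
    have h6 : πhat ω ≠ 0 := (hε0.trans_le h4.1).ne'
    have h7 : (P[A.indicator Z | 𝔪]) ω = π ω • m ω := by
      rw [h2, smul_smul, mul_inv_cancel₀ h5, one_smul]
    have h8 : ((π ω - πhat ω) / πhat ω) • m ω + m ω
        = ((π ω - πhat ω) / πhat ω + 1) • m ω := by rw [add_smul, one_smul]
    rw [h1, Pi.smul_apply', h7, smul_smul, h8]
    congr 1
    field_simp
    ring
  have hkey : (∫ ω, (A.indicator (fun _ => (1 : ℝ)) ω / πhat ω) • Z ω ∂P) - ∫ ω, m ω ∂P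
      = ∫ ω, ((π ω - πhat ω) / πhat ω) • m ω ∂P := by
    rw [hE, integral_add hri hmi, add_sub_cancel_right]
  rw [hkey]
  refine ⟨rfl, ?_⟩
  have hdL : MemLp (fun ω => |πhat ω - π ω|) 2 P := by
    refine MemLp.of_bound (hπh0.sub hπ0).aestronglyMeasurable.norm 1 ?_
    filter_upwards [hdiffb] with ω h
    simpa using h
  have hprod : Integrable (fun ω => |πhat ω - π ω| * ‖m ω‖) P := hdL.integrable_mul hm.norm
  have hCS := integral_mul_le_Lp_mul_Lq_of_nonneg (μ := P) Real.HolderConjugate.two_two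
    (f := fun ω => |πhat ω - π ω|) (g := fun ω => ‖m ω‖)
    (Filter.Eventually.of_forall fun _ => abs_nonneg _)
    (Filter.Eventually.of_forall fun _ => norm_nonneg _) (by simpa using hdL)
    (by simpa using hm.norm)
  simp only [Real.rpow_two, sq_abs, ← Real.sqrt_eq_rpow] at hCS
  calc _ ≤ ∫ ω, ε⁻¹ * (|πhat ω - π ω| * ‖m ω‖) ∂P := by
        refine norm_integral_le_of_norm_le (hprod.const_mul _) ?_
        filter_upwards [hratio] with ω h
        rw [norm_smul, ← mul_assoc]
        exact mul_le_mul_of_nonneg_right h (norm_nonneg _)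
    _ ≤ _ := by
        rw [integral_const_mul, mul_assoc]
        exact mul_le_mul_of_nonneg_left hCS (inv_nonneg.2 hε0.le)
end

section
/- Let (Ω, 𝒜, P) be a probability space, H a real Hilbert space, A ∈ 𝒜 an event, Z : Ω → H strongly measurable with E[‖Z‖⁴] < ∞, and π, π̂ : Ω → ℝ measurable with ε ≤ π ≤ 1 − ε and ε ≤ π̂ ≤ 1 − ε almost surely, for some ε ∈ (0, 1/2). Then E[ ‖ (1_A (π − π̂) / (π̂ · π)) • Z ‖² ] ≤ ε⁻⁴ · (E[(π̂ − π)⁴])^{1/2} · (E[‖Z‖⁴])^{1/2}. -/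
open MeasureTheory

/-- **Second-moment bound on the term `H₁` in the DML analysis.**
If `Z : Ω → H` has `E[‖Z‖⁴] < ∞` and `ε ≤ π, π̂ ≤ 1 − ε` a.s. for some `ε ∈ (0, 1/2)`, then
`E[‖(1_A (π − π̂)/(π̂ π)) • Z‖²] ≤ ε⁻⁴ (E[(π̂ − π)⁴])^{1/2} (E[‖Z‖⁴])^{1/2}`. -/
theorem dml_H1_second_moment_bound
    {Ω : Type*} [MeasurableSpace Ω] (P : Measure Ω) [IsProbabilityMeasure P]
    {H : Type*} [NormedAddCommGroup H] [InnerProductSpace ℝ H] [CompleteSpace H]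
    (A : Set Ω) (hA : MeasurableSet A)
    (Z : Ω → H) (hZmeas : StronglyMeasurable Z) (hZ : MemLp Z 4 P)
    (π πhat : Ω → ℝ) (hπmeas : Measurable π) (hπhatmeas : Measurable πhat)
    (ε : ℝ) (hε : ε ∈ Set.Ioo (0 : ℝ) (1/2))
    (hπ : ∀ᵐ ω ∂P, π ω ∈ Set.Icc ε (1 - ε))
    (hπhat : ∀ᵐ ω ∂P, πhat ω ∈ Set.Icc ε (1 - ε)) :
    ∫ ω, ‖(A.indicator (fun _ => (1 : ℝ)) ω * (π ω - πhat ω) / (πhat ω * π ω)) • Z ω‖ ^ 2 ∂P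
      ≤ ε⁻¹ ^ 4 * Real.sqrt (∫ ω, (πhat ω - π ω) ^ 4 ∂P)
          * Real.sqrt (∫ ω, ‖Z ω‖ ^ 4 ∂P) := by
  obtain ⟨hε0, hε1⟩ := hε
  have hdm : Measurable fun ω => (πhat ω - π ω) ^ 2 := (hπhatmeas.sub hπmeas).pow_const 2
  have hf : MemLp (fun ω => (πhat ω - π ω) ^ 2) 2 P := by
    refine MemLp.of_bound hdm.aestronglyMeasurable 1 ?_
    filter_upwards [hπ, hπhat] with ω h1 h2
    obtain ⟨h1, h1'⟩ := h1
    obtain ⟨h2, h2'⟩ := h2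
    rw [Real.norm_of_nonneg (sq_nonneg _)]
    nlinarith
  have hZ4 : Integrable (fun ω => ‖Z ω‖ ^ 4) P := by
    have := MemLp.integrable_norm_pow (p := 4) (by exact_mod_cast hZ) (by norm_num)
    exact this
  have hg : MemLp (fun ω => ‖Z ω‖ ^ 2) 2 P := by
    refine (memLp_two_iff_integrable_sq (f := fun ω => ‖Z ω‖ ^ 2)
      (hZmeas.norm.pow 2).aestronglyMeasurable).2 ?_
    refine hZ4.congr (Filter.Eventually.of_forall fun ω => ?_)
    simp only
    ring
  have hCS : ∫ ω, (πhat ω - π ω) ^ 2 * ‖Z ω‖ ^ 2 ∂P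
      ≤ Real.sqrt (∫ ω, (πhat ω - π ω) ^ 4 ∂P) * Real.sqrt (∫ ω, ‖Z ω‖ ^ 4 ∂P) := by
    have h := integral_mul_le_Lp_mul_Lq_of_nonneg (μ := P) Real.HolderConjugate.two_two
      (f := fun ω => (πhat ω - π ω) ^ 2) (g := fun ω => ‖Z ω‖ ^ 2)
      (Filter.Eventually.of_forall fun ω => sq_nonneg _)
      (Filter.Eventually.of_forall fun ω => sq_nonneg _)
      (by simpa using hf) (by simpa using hg)
    simp only [Real.rpow_two, ← pow_mul, ← Real.sqrt_eq_rpow] at h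
    exact h
  have hint : Integrable (fun ω => (πhat ω - π ω) ^ 2 * ‖Z ω‖ ^ 2) P := hf.integrable_mul hg
  calc _ ≤ ∫ ω, ε⁻¹ ^ 4 * ((πhat ω - π ω) ^ 2 * ‖Z ω‖ ^ 2) ∂P := by
        refine integral_mono_of_nonneg (Filter.Eventually.of_forall fun ω => sq_nonneg _)
          (hint.const_mul _) ?_
        filter_upwards [hπ, hπhat] with ω h1 h2
        have h1 := h1.1
        have h2 := h2.1
        have hp : 0 < πhat ω * π ω := mul_pos (hε0.trans_le h2) (hε0.trans_le h1)
        have hle : ε ^ 2 ≤ πhat ω * π ω := by nlinarith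
        have hinv : (πhat ω * π ω)⁻¹ ≤ ε⁻¹ ^ 2 := by
          rw [inv_pow]
          exact inv_anti₀ (by positivity) hle
        have hinv2 : ((πhat ω * π ω)⁻¹) ^ 2 ≤ ε⁻¹ ^ 4 := by
          calc _ ≤ (ε⁻¹ ^ 2) ^ 2 := pow_le_pow_left₀ (by positivity) hinv 2
            _ = _ := by ring
        have hind : (A.indicator (fun _ => (1 : ℝ)) ω) ^ 2 ≤ 1 := by
          by_cases h : ω ∈ A <;> simp [h]
        simp only [norm_smul, mul_pow, Real.norm_eq_abs, sq_abs, div_eq_mul_inv]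
        calc _ = (A.indicator (fun _ => (1 : ℝ)) ω) ^ 2 * ((πhat ω * π ω)⁻¹) ^ 2
              * ((πhat ω - π ω) ^ 2 * ‖Z ω‖ ^ 2) := by ring
          _ ≤ 1 * ε⁻¹ ^ 4 * ((πhat ω - π ω) ^ 2 * ‖Z ω‖ ^ 2) := by gcongr
          _ = _ := by ring
    _ = ε⁻¹ ^ 4 * ∫ ω, (πhat ω - π ω) ^ 2 * ‖Z ω‖ ^ 2 ∂P := integral_const_mul _ _
    _ ≤ _ := by
        rw [mul_assoc]
        exact mul_le_mul_of_nonneg_left hCS (by positivity)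
end

section
/- Let (Ω, 𝒜, P) be a probability space, H a real Hilbert space, A ∈ 𝒜 an event, m, m̃ : Ω → H strongly measurable with E[‖m‖⁴] < ∞ and E[‖m − m̃‖²] < ∞, and π, π̂ : Ω → ℝ measurable with ε ≤ π ≤ 1 − ε and ε ≤ π̂ ≤ 1 − ε almost surely, for some ε ∈ (0, 1/2). Then E[ ‖ (1_A / (π̂ · π)) • (π̂ • m − π • m̃) ‖² ] ≤ 2 ε⁻⁴ · (E[(π̂ − π)⁴])^{1/2} · (E[‖m‖⁴])^{1/2} + 2 ε⁻² · E[‖m − m̃‖²]. -/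
open MeasureTheory

/-- **Second-moment bound on the term `H₂` in the DML analysis.**
If `m, m̃ : Ω → H` satisfy `E[‖m‖⁴] < ∞` and `E[‖m − m̃‖²] < ∞`, and
`ε ≤ π, π̂ ≤ 1 − ε` a.s. for some `ε ∈ (0, 1/2)`, then
`E[‖(1_A/(π̂ π)) • (π̂ • m − π • m̃)‖²]
  ≤ 2 ε⁻⁴ (E[(π̂ − π)⁴])^{1/2} (E[‖m‖⁴])^{1/2} + 2 ε⁻² E[‖m − m̃‖²]`. -/
theorem dml_H2_second_moment_bound
    {Ω : Type*} [MeasurableSpace Ω] (P : Measure Ω) [IsProbabilityMeasure P]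
    {H : Type*} [NormedAddCommGroup H] [InnerProductSpace ℝ H] [CompleteSpace H]
    (A : Set Ω) (hA : MeasurableSet A)
    (m mtilde : Ω → H) (hmmeas : StronglyMeasurable m) (hmtmeas : StronglyMeasurable mtilde)
    (hm4 : MemLp m 4 P) (hmdiff : MemLp (fun ω => m ω - mtilde ω) 2 P)
    (π πhat : Ω → ℝ) (hπmeas : Measurable π) (hπhatmeas : Measurable πhat)
    (ε : ℝ) (hε : ε ∈ Set.Ioo (0 : ℝ) (1/2))
    (hπ : ∀ᵐ ω ∂P, π ω ∈ Set.Icc ε (1 - ε))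
    (hπhat : ∀ᵐ ω ∂P, πhat ω ∈ Set.Icc ε (1 - ε)) :
    ∫ ω, ‖(A.indicator (fun _ => (1 : ℝ)) ω / (πhat ω * π ω))
            • (πhat ω • m ω - π ω • mtilde ω)‖ ^ 2 ∂P
      ≤ 2 * ε⁻¹ ^ 4 * Real.sqrt (∫ ω, (πhat ω - π ω) ^ 4 ∂P)
            * Real.sqrt (∫ ω, ‖m ω‖ ^ 4 ∂P)
        + 2 * ε⁻¹ ^ 2 * ∫ ω, ‖m ω - mtilde ω‖ ^ 2 ∂P := by
  obtain ⟨hε0, hε1⟩ := hε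
  have hm4i : Integrable (fun ω => ‖m ω‖ ^ 4) P := by
    have := hm4.integrable_norm_pow (p := 4) (by norm_num)
    exact this
  have hdi : Integrable (fun ω => ‖m ω - mtilde ω‖ ^ 2) P := by
    have := hmdiff.integrable_norm_pow (p := 2) (by norm_num)
    exact this
  have hf : MemLp (fun ω => (πhat ω - π ω) ^ 2) (ENNReal.ofReal 2) P := by
    refine MemLp.of_bound ((hπhatmeas.sub hπmeas).pow_const 2).aestronglyMeasurable 1 ?_
    filter_upwards [hπ, hπhat] with ω h1 h2
    rw [Real.norm_of_nonneg (sq_nonneg _)]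
    nlinarith [h1.1, h1.2, h2.1, h2.2]
  have hg : MemLp (fun ω => ‖m ω‖ ^ 2) (ENNReal.ofReal 2) P := by
    have hmeas : AEStronglyMeasurable (fun ω => ‖m ω‖ ^ 2) P :=
      (hmmeas.norm.pow 2).aestronglyMeasurable
    have : MemLp (fun ω => ‖m ω‖ ^ 2) 2 P := by
      rw [memLp_two_iff_integrable_sq hmeas]
      refine hm4i.congr (Filter.Eventually.of_forall fun ω => ?_)
      simp only
      ring
    simpa using this
  have hCS := integral_mul_le_Lp_mul_Lq_of_nonneg (μ := P) Real.HolderConjugate.two_two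
    (Filter.Eventually.of_forall fun ω => sq_nonneg (πhat ω - π ω))
    (Filter.Eventually.of_forall fun ω => sq_nonneg ‖m ω‖) hf hg
  have e1 : ∀ x : ℝ, (x ^ 2) ^ (2 : ℝ) = x ^ 4 := fun x => by
    rw [Real.rpow_two]; ring
  simp only [e1, ← Real.sqrt_eq_rpow] at hCS
  have hfg : Integrable (fun ω => (πhat ω - π ω) ^ 2 * ‖m ω‖ ^ 2) P := by
    have hf' : MemLp (fun ω => (πhat ω - π ω) ^ 2) 2 P := by simpa using hf
    have hg' : MemLp (fun ω => ‖m ω‖ ^ 2) 2 P := by simpa using hg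
    exact hf'.integrable_mul hg'
  have hpt : ∀ᵐ ω ∂P, ‖(A.indicator (fun _ => (1 : ℝ)) ω / (πhat ω * π ω))
            • (πhat ω • m ω - π ω • mtilde ω)‖ ^ 2
      ≤ 2 * ε⁻¹ ^ 4 * ((πhat ω - π ω) ^ 2 * ‖m ω‖ ^ 2)
        + 2 * ε⁻¹ ^ 2 * ‖m ω - mtilde ω‖ ^ 2 := by
    filter_upwards [hπ, hπhat] with ω h1 h2
    have p1 : 0 < π ω := hε0.trans_le h1.1
    have p2 : 0 < πhat ω := hε0.trans_le h2.1
    have i1 : (π ω)⁻¹ ≤ ε⁻¹ := inv_anti₀ hε0 h1.1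
    have i2 : (πhat ω)⁻¹ ≤ ε⁻¹ := inv_anti₀ hε0 h2.1
    by_cases hω : ω ∈ A
    · have hv : (A.indicator (fun _ => (1 : ℝ)) ω / (πhat ω * π ω))
            • (πhat ω • m ω - π ω • mtilde ω)
          = ((πhat ω)⁻¹ * (π ω)⁻¹ * (πhat ω - π ω)) • m ω
            + (πhat ω)⁻¹ • (m ω - mtilde ω) := by
        rw [Set.indicator_of_mem hω]
        match_scalars <;> field_simp
        ring
      have hn : ‖((πhat ω)⁻¹ * (π ω)⁻¹ * (πhat ω - π ω)) • m ω
            + (πhat ω)⁻¹ • (m ω - mtilde ω)‖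
          ≤ ε⁻¹ * ε⁻¹ * |πhat ω - π ω| * ‖m ω‖ + ε⁻¹ * ‖m ω - mtilde ω‖ := by
        refine (norm_add_le _ _).trans ?_
        rw [norm_smul, norm_smul, norm_mul, norm_mul, Real.norm_of_nonneg (inv_nonneg.2 p1.le),
          Real.norm_of_nonneg (inv_nonneg.2 p2.le), Real.norm_eq_abs]
        gcongr
      rw [hv]
      calc _ ≤ (ε⁻¹ * ε⁻¹ * |πhat ω - π ω| * ‖m ω‖ + ε⁻¹ * ‖m ω - mtilde ω‖) ^ 2 := by
            gcongr
        _ ≤ 2 * ((ε⁻¹ * ε⁻¹ * |πhat ω - π ω| * ‖m ω‖) ^ 2 + (ε⁻¹ * ‖m ω - mtilde ω‖) ^ 2) :=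
            add_sq_le
        _ = _ := by
            rw [← sq_abs (πhat ω - π ω)]; ring
    · rw [Set.indicator_of_notMem hω, zero_div, zero_smul, norm_zero, zero_pow two_ne_zero]
      positivity
  have hI1 := hfg.const_mul (2 * ε⁻¹ ^ 4)
  have hI2 := hdi.const_mul (2 * ε⁻¹ ^ 2)
  calc _ ≤ ∫ ω, (2 * ε⁻¹ ^ 4 * ((πhat ω - π ω) ^ 2 * ‖m ω‖ ^ 2)
        + 2 * ε⁻¹ ^ 2 * ‖m ω - mtilde ω‖ ^ 2) ∂P :=
        integral_mono_of_nonneg (Filter.Eventually.of_forall fun ω => sq_nonneg _)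
          (hI1.add hI2) hpt
    _ = 2 * ε⁻¹ ^ 4 * (∫ ω, (πhat ω - π ω) ^ 2 * ‖m ω‖ ^ 2 ∂P)
        + 2 * ε⁻¹ ^ 2 * ∫ ω, ‖m ω - mtilde ω‖ ^ 2 ∂P := by
        rw [integral_add hI1 hI2, integral_const_mul, integral_const_mul]
    _ ≤ _ := by
        rw [mul_assoc (2 * ε⁻¹ ^ 4)]
        gcongr
end
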